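/- arXiv:0902.2843 — 6 statements merged into one kernel-verified Lean document; each statement's English description precedes it below -/
import Mathlib

section
/- For every τ ∈ ℂ with Im τ > 0 and every z ∈ ℂ, the theta function satisfies the heat-type partial differential equation ∂θ/∂τ (z,τ) = (1/(4πi)) · ∂²θ/∂z² (z,τ) − (1/2) · ∂θ/∂z (z,τ), where ∂θ/∂τ denotes the complex derivative of τ ↦ θ(z,τ) on the upper half-plane and ∂θ/∂z, ∂²θ/∂z² denote the first and second complex derivatives of z ↦ θ(z,τ). -/
open Complex

/-- The theta function `θ(z,τ) = Σ_{n∈ℤ} exp(2πi n z + π i n(n−1) τ)`. -/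
noncomputable def theta (z τ : ℂ) : ℂ :=
  ∑' n : ℤ, Complex.exp (2 * Real.pi * Complex.I * n * z +
    Real.pi * Complex.I * n * (n - 1) * τ)

/-- The `n`-th term of the series defining `theta`. -/
noncomputable def thetaTerm (n : ℤ) (z τ : ℂ) : ℂ :=
  Complex.exp (2 * Real.pi * Complex.I * n * z + Real.pi * Complex.I * n * (n - 1) * τ)

lemma thetaTerm_eq_jacobiTheta₂_term (n : ℤ) (z τ : ℂ) :
    thetaTerm n z τ = jacobiTheta₂_term n (z - τ / 2) τ := by
  unfold thetaTerm jacobiTheta₂_term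
  congr 1
  ring

lemma hasDerivAt_thetaTerm_left (n : ℤ) (z τ : ℂ) :
    HasDerivAt (fun w => thetaTerm n w τ) (2 * Real.pi * Complex.I * n * thetaTerm n z τ) z := by
  have h := (((hasDerivAt_id' z).const_mul (2 * Real.pi * Complex.I * n : ℂ)).add_const
    (Real.pi * Complex.I * n * (n - 1) * τ)).cexp
  exact h.congr_deriv (by unfold thetaTerm; ring)

lemma hasDerivAt_thetaTerm_right (n : ℤ) (z τ : ℂ) :
    HasDerivAt (fun w => thetaTerm n z w)
      (Real.pi * Complex.I * n * (n - 1) * thetaTerm n z τ) τ := by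
  have h := (((hasDerivAt_id' τ).const_mul (Real.pi * Complex.I * n * (n - 1) : ℂ)).const_add
    (2 * Real.pi * Complex.I * n * z)).cexp
  exact h.congr_deriv (by unfold thetaTerm; ring)

lemma isOpen_setOf_abs_im_sub_lt (τ : ℂ) (S : ℝ) : IsOpen {w : ℂ | |(w - τ / 2).im| < S} :=
  isOpen_lt (by fun_prop) continuous_const

lemma hasSum_deriv_theta_left (z : ℂ) {τ : ℂ} (hτ : 0 < τ.im) :
    HasSum (fun n : ℤ => 2 * Real.pi * Complex.I * n * thetaTerm n z τ)
      (deriv (fun w => theta w τ) z) := by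
  obtain ⟨S, hS⟩ := exists_gt |(z - τ / 2).im|
  have h := hasSum_deriv_of_summable_norm (F := fun (n : ℤ) w => thetaTerm n w τ)
    (by simpa only [pow_zero, one_mul] using summable_pow_mul_jacobiTheta₂_term_bound S hτ 0)
    (fun n w _ => (hasDerivAt_thetaTerm_left n w τ).differentiableAt.differentiableWithinAt)
    (isOpen_setOf_abs_im_sub_lt τ S)
    (fun n w hw => by
      rw [thetaTerm_eq_jacobiTheta₂_term]
      exact norm_jacobiTheta₂_term_le hτ (le_of_lt hw) le_rfl n) hS
  simp only [(hasDerivAt_thetaTerm_left _ z τ).deriv] at h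
  exact h

lemma hasSum_deriv_deriv_theta_left (z : ℂ) {τ : ℂ} (hτ : 0 < τ.im) :
    HasSum (fun n : ℤ => 2 * Real.pi * Complex.I * n *
        (2 * Real.pi * Complex.I * n * thetaTerm n z τ))
      (deriv (deriv (fun w => theta w τ)) z) := by
  have hd : deriv (fun w => theta w τ) =
      fun w => ∑' n : ℤ, 2 * Real.pi * Complex.I * n * thetaTerm n w τ :=
    funext fun w => (hasSum_deriv_theta_left w hτ).tsum_eq.symm
  have hderiv (n : ℤ) (w : ℂ) := (hasDerivAt_thetaTerm_left n w τ).const_mul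
    (2 * Real.pi * Complex.I * n : ℂ)
  obtain ⟨S, hS⟩ := exists_gt |(z - τ / 2).im|
  have h := hasSum_deriv_of_summable_norm
    (F := fun (n : ℤ) w => 2 * Real.pi * Complex.I * n * thetaTerm n w τ)
    ((summable_pow_mul_jacobiTheta₂_term_bound S hτ 1).mul_left (2 * Real.pi))
    (fun n w _ => (hderiv n w).differentiableAt.differentiableWithinAt)
    (isOpen_setOf_abs_im_sub_lt τ S)
    (fun n w hw => by
      rw [thetaTerm_eq_jacobiTheta₂_term, pow_one, ← mul_assoc]
      exact norm_jacobiTheta₂'_term_le hτ (le_of_lt hw) le_rfl n) hS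
  rw [hd]
  simpa only [(hderiv _ z).deriv] using h

lemma hasSum_deriv_theta_right (z : ℂ) {τ : ℂ} (hτ : 0 < τ.im) :
    HasSum (fun n : ℤ => Real.pi * Complex.I * n * (n - 1) * thetaTerm n z τ)
      (deriv (fun w => theta z w) τ) := by
  obtain ⟨S, hS⟩ := exists_gt |(z - τ / 2).im|
  obtain ⟨T, hT, hTτ⟩ := exists_between hτ
  have hopen : IsOpen {w : ℂ | T < w.im ∧ |(z - w / 2).im| < S} :=
    
    (isOpen_lt continuous_const continuous_im).inter
      (isOpen_lt (f := fun w : ℂ => |(z - w / 2).im|) (by fun_prop) continuous_const)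
  have h := hasSum_deriv_of_summable_norm (F := fun (n : ℤ) w => thetaTerm n z w)
    (by simpa only [pow_zero, one_mul] using summable_pow_mul_jacobiTheta₂_term_bound S hT 0)
    (fun n w _ => (hasDerivAt_thetaTerm_right n z w).differentiableAt.differentiableWithinAt)
    hopen
    (fun n w hw => by
      rw [thetaTerm_eq_jacobiTheta₂_term]
      exact norm_jacobiTheta₂_term_le hT hw.2.le hw.1.le n) ⟨hTτ, hS⟩
  simp only [(hasDerivAt_thetaTerm_right _ z τ).deriv] at h
  exact h

/-- The heat-type PDE `∂θ/∂τ = (1/(4πi))·∂²θ/∂z² − (1/2)·∂θ/∂z`. -/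
theorem theta_heat_equation (τ : ℂ) (hτ : 0 < τ.im) (z : ℂ) :
    deriv (fun w : ℂ => theta z w) τ =
      1 / (4 * Real.pi * Complex.I) * deriv (deriv (fun w : ℂ => theta w τ)) z -
      1 / 2 * deriv (fun w : ℂ => theta w τ) z := by
  have h := ((hasSum_deriv_deriv_theta_left z hτ).mul_left (1 / (4 * Real.pi * Complex.I))).sub
    ((hasSum_deriv_theta_left z hτ).mul_left (1 / 2))
  rw [← h.tsum_eq, ← (hasSum_deriv_theta_right z hτ).tsum_eq]
  refine tsum_congr fun n => ?_
  have hpi : (Real.pi : ℂ) ≠ 0 := by exact_mod_cast Real.pi_ne_zero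
  field_simp
  ring
end

section
/- For every τ ∈ ℂ with Im τ > 0 and every z ∈ ℂ, θ(z,τ) = 0 if and only if there exist integers m, n ∈ ℤ such that z = 1/2 + m + n·τ. In particular θ has a single zero (located at z = 1/2) in the fundamental region of the lattice ℤ + τℤ. -/
open Complex

open Filter Topology Finset

/-- The finite `q`-Pochhammer symbol `(q; q)_n`. -/
noncomputable def qPoch (q : ℂ) (n : ℕ) : ℂ := ∏ k ∈ range n, (1 - q ^ (k + 1))

/-- The reciprocal of `(q; q)_m`, extended by zero to negative integers `m`. -/
noncomputable def invQPoch (q : ℂ) (m : ℤ) : ℂ := if m < 0 then 0 else (qPoch q m.toNat)⁻¹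

lemma one_sub_pow_succ_ne_zero {q : ℂ} (hq : ‖q‖ < 1) (k : ℕ) : 1 - q ^ (k + 1) ≠ 0 := by
  intro h
  have h1 : ‖q ^ (k + 1)‖ = 1 := by rw [← sub_eq_zero.mp h, norm_one]
  rw [norm_pow] at h1
  exact (pow_lt_one₀ (norm_nonneg q) hq k.succ_ne_zero).ne h1

lemma qPoch_ne_zero {q : ℂ} (hq : ‖q‖ < 1) (n : ℕ) : qPoch q n ≠ 0 :=
  prod_ne_zero_iff.mpr fun k _ => one_sub_pow_succ_ne_zero hq k

lemma invQPoch_natCast (q : ℂ) (n : ℕ) : invQPoch q n = (qPoch q n)⁻¹ := by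
  simp [invQPoch]

lemma invQPoch_of_neg (q : ℂ) {m : ℤ} (hm : m < 0) : invQPoch q m = 0 := if_pos hm

lemma invQPoch_sub_one {q : ℂ} (hq : ‖q‖ < 1) (m : ℤ) :
    invQPoch q (m - 1) = (1 - q ^ m) * invQPoch q m := by
  rcases lt_trichotomy m 0 with hm | rfl | hm
  · rw [invQPoch_of_neg q hm, invQPoch_of_neg q (by omega), mul_zero]
  · rw [invQPoch_of_neg q (by omega)]
    simp
  · obtain ⟨n, rfl⟩ : ∃ n : ℕ, m = (n + 1 : ℕ) := ⟨(m - 1).toNat, by omega⟩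
    rw [show ((n + 1 : ℕ) : ℤ) - 1 = n by simp, invQPoch_natCast, invQPoch_natCast, zpow_natCast]
    have h1 := qPoch_ne_zero hq n
    have h2 := one_sub_pow_succ_ne_zero hq n
    rw [qPoch, qPoch, prod_range_succ]
    rw [qPoch] at h1
    field_simp

/-- The finite form of the Jacobi triple product. -/
lemma hasSum_finite_triple_product {t w : ℂ} (ht : t ≠ 0) (hw : w ≠ 0) (hq : ‖t ^ 2‖ < 1)
    (A B : ℕ) :
    HasSum (fun n : ℤ => qPoch (t ^ 2) (A + B) * invQPoch (t ^ 2) (B + n) *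
        invQPoch (t ^ 2) (A - n) * (t ^ (n * (n - 1)) * w ^ n))
      ((∏ k ∈ range A, (1 + (t ^ 2) ^ k * w)) * ∏ k ∈ range B, (1 + (t ^ 2) ^ (k + 1) * w⁻¹)) := by
  induction B with
  | zero =>
    induction A with
    | zero =>
      convert hasSum_single (0 : ℤ) ?_ using 1
      · simp [invQPoch, qPoch]
      · intro n hn
        rcases lt_or_gt_of_ne hn with h | h
        · rw [invQPoch_of_neg (m := ((0 : ℕ) : ℤ) + n) _ (by simpa using h)]; simp
        · rw [invQPoch_of_neg (m := ((0 : ℕ) : ℤ) - n) _ (by simpa using h)]; simp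
    | succ A ih =>
      have ih' := ((Equiv.subRight (1 : ℤ)).hasSum_iff.mpr ih).mul_left ((t ^ 2) ^ A * w)
      convert ih.add ih' using 1
      · ext n
        simp only [Function.comp_apply, Equiv.subRight_apply]
        have e1 := invQPoch_sub_one hq (((A + 1 : ℕ) : ℤ) - n)
        have e2 := invQPoch_sub_one hq (((0 : ℕ) : ℤ) + n)
        rw [show ((A + 1 : ℕ) : ℤ) - n - 1 = A - n by push_cast; ring] at e1
        rw [show ((0 : ℕ) : ℤ) + n - 1 = ((0 : ℕ) : ℤ) + (n - 1) by ring] at e2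
        rw [e1, e2, show (A : ℤ) - (n - 1) = ((A + 1 : ℕ) : ℤ) - n by push_cast; ring]
        have e3 : t ^ (n * (n - 1)) = (t ^ 2) ^ n * (t ^ 2)⁻¹ * t ^ ((n - 1) * (n - 1 - 1)) := by
          rw [← zpow_natCast t 2, ← zpow_neg, ← zpow_mul, ← zpow_add₀ ht, ← zpow_add₀ ht]
          congr 1; push_cast; ring
        have e4 : w ^ n = w ^ (n - 1) * w := by rw [← zpow_add_one₀ hw]; simp
        have e5 : (t ^ 2) ^ (((A + 1 : ℕ) : ℤ) - n) = (t ^ 2) ^ A * t ^ 2 * ((t ^ 2) ^ n)⁻¹ := by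
          rw [zpow_sub₀ (pow_ne_zero 2 ht), zpow_natCast, pow_succ, div_eq_mul_inv]
        have e6 : qPoch (t ^ 2) (A + 1 + 0)
            = qPoch (t ^ 2) (A + 0) * (1 - (t ^ 2) ^ A * t ^ 2) := by
          simp only [add_zero, qPoch, prod_range_succ, pow_succ]
        have hz : (t ^ 2) ^ n ≠ 0 := zpow_ne_zero _ (pow_ne_zero 2 ht)
        rw [e3, e4, e5, e6, show ((0 : ℕ) : ℤ) + n = n by simp]
        generalize (t ^ 2) ^ n = Q at *
        field_simp
        ring
      · rw [prod_range_succ]; ring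
  | succ B ih =>
    have ih' := ((Equiv.addRight (1 : ℤ)).hasSum_iff.mpr ih).mul_left ((t ^ 2) ^ (B + 1) * w⁻¹)
    convert ih.add ih' using 1
    · ext n
      simp only [Function.comp_apply, Equiv.coe_addRight]
      have e1 := invQPoch_sub_one hq (((B + 1 : ℕ) : ℤ) + n)
      have e2 := invQPoch_sub_one hq ((A : ℤ) - n)
      rw [show ((B + 1 : ℕ) : ℤ) + n - 1 = B + n by push_cast; ring] at e1
      rw [show (A : ℤ) - n - 1 = A - (n + 1) by ring] at e2
      rw [e1, e2, show (B : ℤ) + (n + 1) = ((B + 1 : ℕ) : ℤ) + n by push_cast; ring]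
      have e3 : t ^ ((n + 1) * (n + 1 - 1)) = (t ^ 2) ^ n * t ^ (n * (n - 1)) := by
        rw [← zpow_natCast t 2, ← zpow_mul, ← zpow_add₀ ht]
        congr 1; push_cast; ring
      have e4 : w ^ (n + 1) = w ^ n * w := zpow_add_one₀ hw n
      have e5 : (t ^ 2) ^ (((B + 1 : ℕ) : ℤ) + n) = (t ^ 2) ^ B * t ^ 2 * (t ^ 2) ^ n := by
        rw [zpow_add₀ (pow_ne_zero 2 ht), zpow_natCast, pow_succ]
      have e7 : (t ^ 2) ^ ((A : ℤ) - n) = (t ^ 2) ^ A * ((t ^ 2) ^ n)⁻¹ := by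
        rw [zpow_sub₀ (pow_ne_zero 2 ht), zpow_natCast, div_eq_mul_inv]
      have e6 : qPoch (t ^ 2) (A + (B + 1))
          = qPoch (t ^ 2) (A + B) * (1 - (t ^ 2) ^ A * (t ^ 2) ^ B * t ^ 2) := by
        simp only [← add_assoc, qPoch, prod_range_succ, pow_succ, pow_add]
      have hz : (t ^ 2) ^ n ≠ 0 := zpow_ne_zero _ (pow_ne_zero 2 ht)
      rw [e3, e4, e5, e6, e7]
      generalize (t ^ 2) ^ n = Q at *
      field_simp
      ring
    · rw [prod_range_succ _ B]; ring

lemma tendsto_prod_one_add_mul_pow {q : ℂ} (hq : ‖q‖ < 1) (c : ℂ) :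
    ∃ L, Tendsto (fun N => ∏ k ∈ range N, (1 + q ^ k * c)) atTop (𝓝 L) ∧
      (L = 0 ↔ ∃ k : ℕ, 1 + q ^ k * c = 0) := by
  have hs : Summable fun k : ℕ => ‖q ^ k * c‖ := by
    simpa [norm_mul, norm_pow] using
      (summable_geometric_of_lt_one (norm_nonneg q) hq).mul_right ‖c‖
  have hlim := (multipliable_one_add_of_summable hs).tendsto_prod_tprod_nat
  refine ⟨_, hlim, fun h => ?_, ?_⟩
  · by_contra! hne
    exact tprod_one_add_ne_zero_of_summable hne hs h
  · rintro ⟨k, hk⟩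
    refine tendsto_nhds_unique hlim (tendsto_const_nhds.congr' ?_)
    filter_upwards [eventually_gt_atTop k] with N hN
    exact (prod_eq_zero (mem_range.mpr hN) hk).symm

lemma exists_tendsto_qPoch {q : ℂ} (hq : ‖q‖ < 1) :
    ∃ L, L ≠ 0 ∧ Tendsto (qPoch q) atTop (𝓝 L) := by
  obtain ⟨L, hL, h0⟩ := tendsto_prod_one_add_mul_pow hq (-q)
  have hterm (k : ℕ) : 1 + q ^ k * -q = 1 - q ^ (k + 1) := by ring
  simp only [hterm] at hL h0
  refine ⟨L, fun h => ?_, hL⟩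
  obtain ⟨k, hk⟩ := h0.mp h
  exact one_sub_pow_succ_ne_zero hq k hk

lemma exists_tendsto_invQPoch {q : ℂ} (hq : ‖q‖ < 1) :
    ∃ L, L ≠ 0 ∧ Tendsto (invQPoch q) atTop (𝓝 L) := by
  obtain ⟨L, hL, h⟩ := exists_tendsto_qPoch hq
  refine ⟨L⁻¹, inv_ne_zero hL, ?_⟩
  have htoNat : Tendsto Int.toNat atTop atTop :=
    tendsto_atTop.mpr fun b => (eventually_ge_atTop (b : ℤ)).mono fun m hm => by omega
  refine ((h.inv₀ hL).comp htoNat).congr' ?_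
  filter_upwards [eventually_ge_atTop (0 : ℤ)] with m hm
  simp [invQPoch, hm.not_gt]

lemma exists_norm_qPoch_le {q : ℂ} (hq : ‖q‖ < 1) : ∃ K, ∀ n, ‖qPoch q n‖ ≤ K := by
  obtain ⟨L, -, h⟩ := exists_tendsto_qPoch hq
  obtain ⟨K, hK⟩ := (Metric.isBounded_range_of_tendsto _ h).exists_norm_le
  exact ⟨K, fun n => hK _ ⟨n, rfl⟩⟩

lemma exists_norm_invQPoch_le {q : ℂ} (hq : ‖q‖ < 1) : ∃ K, ∀ m, ‖invQPoch q m‖ ≤ K := by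
  obtain ⟨L, hL, h⟩ := exists_tendsto_qPoch hq
  obtain ⟨K, hK⟩ := (Metric.isBounded_range_of_tendsto _ (h.inv₀ hL)).exists_norm_le
  refine ⟨K, fun m => ?_⟩
  rw [invQPoch]
  split_ifs
  · simpa using (norm_nonneg _).trans (hK _ ⟨0, rfl⟩)
  · exact hK _ ⟨m.toNat, rfl⟩

/-- The Jacobi triple product, up to a nonzero constant depending only on `t`. -/
lemma tendsto_triple_product {t w : ℂ} (ht : t ≠ 0) (hw : w ≠ 0) (hq : ‖t ^ 2‖ < 1)
    (hs : Summable fun n : ℤ => t ^ (n * (n - 1)) * w ^ n) :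
    ∃ C, C ≠ 0 ∧ Tendsto (fun N => (∏ k ∈ range N, (1 + (t ^ 2) ^ k * w)) *
        ∏ k ∈ range N, (1 + (t ^ 2) ^ (k + 1) * w⁻¹)) atTop
      (𝓝 (C * ∑' n : ℤ, t ^ (n * (n - 1)) * w ^ n)) := by
  obtain ⟨L, hL, hD⟩ := exists_tendsto_qPoch hq
  obtain ⟨L', hL', hI⟩ := exists_tendsto_invQPoch hq
  obtain ⟨K, hK⟩ := exists_norm_qPoch_le hq
  obtain ⟨K', hK'⟩ := exists_norm_invQPoch_le hq
  have hK0 : 0 ≤ K := (norm_nonneg _).trans (hK 0)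
  have hK0' : 0 ≤ K' := (norm_nonneg _).trans (hK' 0)
  refine ⟨L * L' * L', by simp [hL, hL'], ?_⟩
  rw [← tsum_mul_left]
  simp_rw [← (hasSum_finite_triple_product ht hw hq _ _).tsum_eq]
  refine tendsto_tsum_of_dominated_convergence (hs.norm.mul_left (K * K' * K'))
    (fun n => ?_) (.of_forall fun N n => ?_)
  · have hcast : Tendsto (fun N : ℕ => (N : ℤ)) atTop atTop := tendsto_natCast_atTop_atTop
    refine Tendsto.mul_const _ (((hD.comp ?_).mul (hI.comp ?_)).mul (hI.comp ?_))
    · exact tendsto_atTop_mono (fun N => Nat.le_add_right N N) tendsto_id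
    · exact tendsto_atTop_add_const_right _ n hcast
    · exact tendsto_atTop_add_const_right _ (-n) hcast
  · rw [norm_mul, norm_mul, norm_mul]
    gcongr
    exacts [hK _, hK' _, hK' _]

lemma tsum_triple_product_eq_zero_iff {t w : ℂ} (ht : t ≠ 0) (hw : w ≠ 0) (hq : ‖t ^ 2‖ < 1)
    (hs : Summable fun n : ℤ => t ^ (n * (n - 1)) * w ^ n) :
    ∑' n : ℤ, t ^ (n * (n - 1)) * w ^ n = 0 ↔ ∃ k : ℤ, (t ^ 2) ^ k * w = -1 := by
  obtain ⟨C, hC, hlim⟩ := tendsto_triple_product ht hw hq hs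
  obtain ⟨L₁, h₁, h₁'⟩ := tendsto_prod_one_add_mul_pow hq w
  obtain ⟨L₂, h₂, h₂'⟩ := tendsto_prod_one_add_mul_pow hq (t ^ 2 * w⁻¹)
  simp only [← mul_assoc, ← pow_succ] at h₂ h₂'
  have key := tendsto_nhds_unique hlim (h₁.mul h₂)
  have hswap (k : ℕ) : 1 + (t ^ 2) ^ (k + 1) * w⁻¹ = 0 ↔
      (t ^ 2) ^ (-((k + 1 : ℕ) : ℤ)) * w = -1 := by
    have : (t ^ 2) ^ (k + 1) ≠ 0 := pow_ne_zero _ (pow_ne_zero 2 ht)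
    rw [zpow_neg, zpow_natCast]
    generalize (t ^ 2) ^ (k + 1) = Q at *
    field_simp
    constructor <;> intro h <;> linear_combination h
  rw [← mul_eq_zero_iff_left hC, key, mul_eq_zero, h₁', h₂']
  constructor
  · rintro (⟨k, hk⟩ | ⟨k, hk⟩)
    · exact ⟨k, by rw [zpow_natCast]; linear_combination hk⟩
    · exact ⟨_, (hswap k).mp hk⟩
  · rintro ⟨k, hk⟩
    rcases le_or_gt 0 k with h | h
    · lift k to ℕ using h
      rw [zpow_natCast] at hk
      exact Or.inl ⟨k, by linear_combination hk⟩
    · obtain ⟨n, rfl⟩ : ∃ n : ℕ, k = -((n + 1 : ℕ) : ℤ) := ⟨(-k - 1).toNat, by omega⟩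
      exact Or.inr ⟨n, (hswap n).mpr hk⟩

lemma theta_term_eq (z τ : ℂ) (n : ℤ) :
    exp (2 * Real.pi * I * n * z + Real.pi * I * n * (n - 1) * τ) =
      exp (Real.pi * I * τ) ^ (n * (n - 1)) * exp (2 * Real.pi * I * z) ^ n := by
  rw [← exp_int_mul, ← exp_int_mul, ← exp_add]
  congr 1
  push_cast
  ring

lemma summable_theta_term (z : ℂ) {τ : ℂ} (hτ : 0 < τ.im) :
    Summable fun n : ℤ => exp (2 * Real.pi * I * n * z + Real.pi * I * n * (n - 1) * τ) := by
  refine ((summable_jacobiTheta₂_term_iff (z - τ / 2) τ).mpr hτ).congr fun n => ?_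
  rw [jacobiTheta₂_term]
  congr 1
  ring

/-- The zeros of `θ(·,τ)` are exactly the points `1/2 + m + n·τ`, `m n : ℤ`; i.e. `θ`
has a single zero (at `z = 1/2`) in the fundamental region of the lattice `ℤ + τℤ`. -/
theorem theta_zero_iff (τ : ℂ) (hτ : 0 < τ.im) (z : ℂ) :
    theta z τ = 0 ↔ ∃ m n : ℤ, z = 1 / 2 + (m : ℂ) + (n : ℂ) * τ := by
  have hs := summable_theta_term z hτ
  rw [theta]
  simp only [theta_term_eq] at hs ⊢
  have hq : ‖exp (Real.pi * I * τ) ^ 2‖ < 1 := by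
    rw [norm_pow, norm_exp]
    refine pow_lt_one₀ (Real.exp_pos _).le (Real.exp_lt_one_iff.mpr ?_) two_ne_zero
    simpa using mul_pos Real.pi_pos hτ
  rw [tsum_triple_product_eq_zero_iff (exp_ne_zero _) (exp_ne_zero _) hq hs]
  have hpi : (2 * Real.pi * I : ℂ) ≠ 0 := two_pi_I_ne_zero
  have hiff (k : ℤ) : (exp (Real.pi * I * τ) ^ 2) ^ k * exp (2 * Real.pi * I * z) = -1 ↔
      ∃ m : ℤ, z = 1 / 2 + (m : ℂ) + ((-k : ℤ) : ℂ) * τ := by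
    rw [← exp_nat_mul, ← exp_int_mul, ← exp_add, ← exp_pi_mul_I, exp_eq_exp_iff_exists_int]
    refine exists_congr fun m => ⟨fun h => mul_left_cancel₀ hpi ?_, fun h => ?_⟩
    · push_cast at h ⊢
      linear_combination h
    · rw [h]
      push_cast
      ring
  simp only [hiff]
  rw [exists_comm]
  exact exists_congr fun m => (Equiv.neg ℤ).exists_congr_left.trans (by simp)
end

section
/- Fix τ ∈ ℂ with Im τ > 0 and an integer k ≥ 1. The set of entire functions f : ℂ → ℂ (f differentiable on all of ℂ) satisfying f(z+1) = f(z) and f(z+τ) = exp(−2πi k z)·f(z) for all z ∈ ℂ is a ℂ-linear subspace of the space of functions ℂ → ℂ, and its dimension over ℂ equals k. -/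
open Complex

/-- The space of theta functions of degree `k` with respect to the lattice `ℤ + ℤ τ`. -/
def thetaSpace (τ : ℂ) (k : ℕ) : Submodule ℂ (ℂ → ℂ) where
  carrier := {f : ℂ → ℂ | Differentiable ℂ f ∧ (∀ z : ℂ, f (z + 1) = f z) ∧
    ∀ z : ℂ, f (z + τ) = Complex.exp (-(2 * Real.pi * Complex.I * k * z)) * f z}
  zero_mem' := ⟨differentiable_const 0, by simp, by simp⟩
  add_mem' := by
    rintro f g ⟨hf, hf1, hfτ⟩ ⟨hg, hg1, hgτ⟩
    exact ⟨hf.add hg, fun z => by simp [hf1, hg1], fun z => by simp [hfτ, hgτ, mul_add]⟩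
  smul_mem' := by
    rintro c f ⟨hf, hf1, hfτ⟩
    exact ⟨hf.const_smul c, fun z => by simp [hf1], fun z => by
      simp only [Pi.smul_apply, smul_eq_mul, hfτ]; ring⟩

/-- The integral of an entire `1`-periodic function over a horizontal period is independent
of the height. -/
lemma integral_add_eq_of_periodic {g : ℂ → ℂ} (hg : Differentiable ℂ g)
    (hg1 : ∀ z, g (z + 1) = g z) (w : ℂ) :
    ∫ x in (0 : ℝ)..1, g (x + w) = ∫ x in (0 : ℝ)..1, g x := by
  obtain ⟨P, hP⟩ := hg.isExactOn_univ
  have hP' : ∀ z, HasDerivAt P (g z) z := fun z => hP z (Set.mem_univ z)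
  have key : ∀ v : ℂ, ∫ x in (0 : ℝ)..1, g (x + v) = P (v + 1) - P v := by
    intro v
    rw [intervalIntegral.integral_eq_sub_of_hasDerivAt (f := fun x : ℝ => P (x + v))]
    · simp [add_comm]
    · intro x _
      exact ((hP' (x + v)).comp_add_const (x : ℂ) v).comp_ofReal
    · exact (hg.continuous.comp (by fun_prop)).intervalIntegrable _ _
  have hd : ∀ z, HasDerivAt (fun z => P (z + 1) - P z) 0 z := by
    intro z
    have := ((hP' (z + 1)).comp_add_const z 1).sub (hP' z)
    rwa [hg1, sub_self] at this
  have h0 := key 0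
  simp only [add_zero] at h0
  rw [key w, h0]
  simpa using is_const_of_deriv_eq_zero (fun z => (hd z).differentiableAt)
    (fun z => (hd z).deriv) w 0

/-- The Fourier coefficients on the real line, as linear functionals on `thetaSpace τ k`. -/
noncomputable def thetaCoeff (τ : ℂ) (k : ℕ) (n : ℤ) : thetaSpace τ k →ₗ[ℂ] ℂ where
  toFun f := ∫ x in (0 : ℝ)..1, exp (-(2 * Real.pi * I * n * x)) * f.1 x
  map_add' f g := by
    have hf := f.2.1.continuous
    have hg := g.2.1.continuous
    rw [← intervalIntegral.integral_add]
    · simp [mul_add]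
    · exact Continuous.intervalIntegrable (by fun_prop) _ _
    · exact Continuous.intervalIntegrable (by fun_prop) _ _
  map_smul' c f := by
    simp only [RingHom.id_apply, smul_eq_mul]
    rw [← intervalIntegral.integral_const_mul]
    congr 1
    ext x
    simp only [SetLike.val_smul, Pi.smul_apply, smul_eq_mul]
    ring

lemma exp_neg_two_pi_mul_add_one (n : ℤ) (z : ℂ) :
    exp (-(2 * Real.pi * I * n * (z + 1))) = exp (-(2 * Real.pi * I * n * z)) := by
  rw [exp_eq_exp_iff_exists_int]
  exact ⟨-n, by push_cast; ring⟩

lemma thetaCoeff_eq_mul (τ : ℂ) (k : ℕ) (n : ℤ) (f : thetaSpace τ k) :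
    thetaCoeff τ k n f = exp (-(2 * Real.pi * I * n * τ)) * thetaCoeff τ k (n + k) f := by
  have hf := f.2.1
  have h := integral_add_eq_of_periodic
    (g := fun z => exp (-(2 * Real.pi * I * n * z)) * f.1 z) (by fun_prop)
    (fun z => by rw [exp_neg_two_pi_mul_add_one, f.2.2.1]) τ
  simp only [thetaCoeff, LinearMap.coe_mk, AddHom.coe_mk]
  rw [← h, ← intervalIntegral.integral_const_mul]
  congr 1
  ext x
  rw [f.2.2.2, ← mul_assoc, ← mul_assoc, ← exp_add, ← exp_add]
  congr 2
  push_cast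
  ring

lemma thetaCoeff_add_mul_eq_zero_iff (τ : ℂ) (k : ℕ) (n m : ℤ) (f : thetaSpace τ k) :
    thetaCoeff τ k (n + m * k) f = 0 ↔ thetaCoeff τ k n f = 0 := by
  have step : ∀ n : ℤ, thetaCoeff τ k (n + k) f = 0 ↔ thetaCoeff τ k n f = 0 := fun n => by
    rw [thetaCoeff_eq_mul τ k n f]
    simp [exp_ne_zero]
  induction m using Int.induction_on with
  | zero => simp
  | succ i ih =>
    rw [show n + (i + 1) * k = n + i * k + k by ring]
    exact (step _).trans ih
  | pred i ih =>
    refine (step _).symm.trans ?_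
    rwa [show n + (-i - 1) * k + k = n + -i * k by ring]

lemma eq_zero_of_thetaCoeff_eq_zero (τ : ℂ) (k : ℕ) (f : thetaSpace τ k)
    (h : ∀ n, thetaCoeff τ k n f = 0) : f = 0 := by
  have hf := f.2.1
  have hper : Function.Periodic (fun x : ℝ => f.1 x) 1 := fun x => by
    simpa using f.2.2.1 x
  let F : C(AddCircle (1 : ℝ), ℂ) :=
    ⟨hper.lift, continuous_coinduced_dom.mpr (hf.continuous.comp continuous_ofReal)⟩
  have hF : ∀ n, fourierCoeff F n = 0 := by
    intro n
    rw [fourierCoeff_eq_intervalIntegral F n 0, zero_add]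
    have hn := h n
    simp only [thetaCoeff, LinearMap.coe_mk, AddHom.coe_mk] at hn
    rw [div_one, one_smul, ← hn]
    congr 1
    ext x
    rw [fourier_coe_apply, smul_eq_mul]
    congr 2
    push_cast
    ring
  have hzero : ∀ x : ℝ, f.1 x = 0 := by
    intro x
    have hs := has_pointwise_sum_fourier_series_of_summable (f := F)
      (by simp [funext hF]) (x : AddCircle (1 : ℝ))
    simp only [hF, zero_smul] at hs
    exact hs.unique hasSum_zero
  apply Subtype.ext
  refine AnalyticOnNhd.eq_of_frequently_eq (z₀ := 0)
    (fun z _ => hf.analyticAt z) (fun z _ => analyticAt_const) ?_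
  have ht : Filter.Tendsto (fun x : ℝ => (x : ℂ)) (nhdsWithin 0 {0}ᶜ) (nhdsWithin 0 {0}ᶜ) := by
    refine tendsto_nhdsWithin_iff.mpr ⟨?_, ?_⟩
    · exact (continuous_ofReal.tendsto' 0 0 ofReal_zero).mono_left nhdsWithin_le_nhds
    · filter_upwards [self_mem_nhdsWithin] with x hx
      simpa using hx
  exact ht.frequently (Filter.Frequently.of_forall fun x => hzero x)

lemma exists_jacobiTheta₂_ne_zero {τ : ℂ} (hτ : 0 < τ.im) : ∃ z, jacobiTheta₂ z τ ≠ 0 := by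
  by_contra! hz
  have hnorm : ∀ (n : ℤ) (x : ℝ), ‖jacobiTheta₂_term n x τ‖ = ‖jacobiTheta₂_term n 0 τ‖ := by
    intro n x
    simp [norm_jacobiTheta₂_term]
  have hint := intervalIntegral.hasSum_integral_of_dominated_convergence
    (μ := MeasureTheory.volume) (a := 0) (b := 1)
    (F := fun (n : ℤ) (x : ℝ) => jacobiTheta₂_term n x τ)
    (f := fun x : ℝ => jacobiTheta₂ x τ)
    (fun n _ => ‖jacobiTheta₂_term n 0 τ‖)
    (fun n => Continuous.aestronglyMeasurable (by unfold jacobiTheta₂_term; fun_prop))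
    (fun n => .of_forall fun x _ => (hnorm n x).le)
    (.of_forall fun x _ => ((summable_jacobiTheta₂_term_iff 0 τ).mpr hτ).norm)
    (by simp)
    (.of_forall fun x _ => hasSum_jacobiTheta₂_term x hτ)
  have hterm : ∀ n : ℤ, n ≠ 0 → ∫ x in (0 : ℝ)..1, jacobiTheta₂_term n x τ = 0 := by
    intro n hn
    have hc : 2 * Real.pi * I * n ≠ 0 := by simp [Real.pi_ne_zero, hn]
    simp only [jacobiTheta₂_term, exp_add]
    rw [intervalIntegral.integral_mul_const, integral_exp_mul_complex hc]
    have : exp (2 * Real.pi * I * n) = 1 := exp_eq_one_iff.mpr ⟨n, by ring⟩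
    simp [this]
  have hone := hint.unique (hasSum_single 0 hterm)
  simp [hz, jacobiTheta₂_term] at hone

/-- Riemann's theta functions with characteristics, an eigenbasis of `thetaSpace τ k` for the
translation by `1 / k`. -/
noncomputable def thetaBasisFun (τ : ℂ) (k j : ℕ) (z : ℂ) : ℂ :=
  exp (2 * Real.pi * I * j * z) * jacobiTheta₂ (k * z + (j * τ - k * τ / 2)) (k * τ)

lemma thetaBasisFun_mem {τ : ℂ} (hτ : 0 < τ.im) {k : ℕ} (hk : 1 ≤ k) (j : ℕ) :
    thetaBasisFun τ k j ∈ thetaSpace τ k := by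
  have hkτ : 0 < (k * τ : ℂ).im := by
    rw [← ofReal_natCast, im_ofReal_mul]
    positivity
  refine ⟨fun z => ?_, fun z => ?_, fun z => ?_⟩
  · refine DifferentiableAt.mul (by fun_prop) ?_
    exact (differentiableAt_jacobiTheta₂_fst _ hkτ).comp z
      (f := fun z : ℂ => k * z + (j * τ - k * τ / 2)) (by fun_prop)
  · have hper : ∀ w : ℂ, jacobiTheta₂ (w + k) (k * τ) = jacobiTheta₂ w (k * τ) := by
      intro w
      have h : Function.Periodic (fun z => jacobiTheta₂ z (k * τ)) 1 :=
        fun z => jacobiTheta₂_add_left z _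
      simpa using h.nat_mul k w
    have he : exp (2 * Real.pi * I * j * (z + 1)) = exp (2 * Real.pi * I * j * z) :=
      exp_eq_exp_iff_exists_int.mpr ⟨j, by push_cast; ring⟩
    rw [thetaBasisFun, thetaBasisFun, he, ← hper (k * z + _)]
    ring_nf
  · have h := jacobiTheta₂_add_left' (k * z + (j * τ - k * τ / 2)) (k * τ)
    have harg : k * (z + τ) + (j * τ - k * τ / 2) =
      k * z + (j * τ - k * τ / 2) + k * τ := by ring
    rw [thetaBasisFun, thetaBasisFun, harg, h, ← mul_assoc, ← mul_assoc, ← exp_add, ← exp_add]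
    congr 2
    ring

lemma thetaBasisFun_ne_zero {τ : ℂ} (hτ : 0 < τ.im) {k : ℕ} (hk : 1 ≤ k) (j : ℕ) :
    thetaBasisFun τ k j ≠ 0 := by
  have hkτ : 0 < (k * τ : ℂ).im := by
    rw [← ofReal_natCast, im_ofReal_mul]
    positivity
  have hk0 : (k : ℂ) ≠ 0 := by exact_mod_cast (by lia : k ≠ 0)
  obtain ⟨w, hw⟩ := exists_jacobiTheta₂_ne_zero hkτ
  intro h
  have hz := congrFun h ((w - (j * τ - k * τ / 2)) / k)
  rw [thetaBasisFun, mul_div_cancel₀ _ hk0, sub_add_cancel] at hz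
  simp [exp_ne_zero, hw] at hz

lemma thetaBasisFun_add_inv (τ : ℂ) {k : ℕ} (hk : 1 ≤ k) (j : ℕ) (z : ℂ) :
    thetaBasisFun τ k j (z + 1 / k) =
      exp (2 * Real.pi * I / k) ^ j * thetaBasisFun τ k j z := by
  have hk0 : (k : ℂ) ≠ 0 := by exact_mod_cast (by lia : k ≠ 0)
  have harg : k * (z + 1 / k) + (j * τ - k * τ / 2) =
    k * z + (j * τ - k * τ / 2) + 1 := by field_simp; ring
  rw [thetaBasisFun, thetaBasisFun, harg, jacobiTheta₂_add_left, ← exp_nat_mul, ← mul_assoc,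
    ← exp_add]
  congr 2
  ring

lemma linearIndependent_thetaBasisFun {τ : ℂ} (hτ : 0 < τ.im) {k : ℕ} (hk : 1 ≤ k) :
    LinearIndependent ℂ (fun j : Fin k => thetaBasisFun τ k j) := by
  refine Module.End.eigenvectors_linearIndependent'
    (LinearMap.funLeft ℂ ℂ (fun z : ℂ => z + 1 / k))
    (fun j : Fin k => exp (2 * Real.pi * I / k) ^ (j : ℕ)) ?_ _ ?_
  · intro i j hij
    exact Fin.ext ((isPrimitiveRoot_exp k (by lia)).pow_inj i.2 j.2 hij)
  · intro j
    refine ⟨Module.End.mem_eigenspace_iff.mpr ?_, thetaBasisFun_ne_zero hτ hk j⟩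
    ext z
    exact thetaBasisFun_add_inv τ hk j z

lemma finrank_thetaSpace {τ : ℂ} (hτ : 0 < τ.im) {k : ℕ} (hk : 1 ≤ k) :
    Module.finrank ℂ (thetaSpace τ k) = k := by
  let L : thetaSpace τ k →ₗ[ℂ] (Fin k → ℂ) := LinearMap.pi fun j => thetaCoeff τ k (j : ℕ)
  have hL : Function.Injective L := by
    rw [injective_iff_map_eq_zero]
    intro f hf
    refine eq_zero_of_thetaCoeff_eq_zero τ k f fun n => ?_
    have hpos : (0 : ℤ) < k := by exact_mod_cast hk
    have h0 := n.emod_nonneg hpos.ne'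
    have hlt := n.emod_lt_of_pos hpos
    have hr := congrFun hf ⟨(n % k).toNat, by lia⟩
    simp only [L, LinearMap.pi_apply, Int.toNat_of_nonneg h0, Pi.zero_apply] at hr
    rw [← thetaCoeff_add_mul_eq_zero_iff τ k _ (n / k)] at hr
    rwa [mul_comm, Int.emod_add_mul_ediv] at hr
  have := Module.Finite.of_injective L hL
  apply le_antisymm
  · simpa using LinearMap.finrank_le_finrank_of_injective hL
  · have hli : LinearIndependent ℂ
        (fun j : Fin k => (⟨_, thetaBasisFun_mem hτ hk j⟩ : thetaSpace τ k)) :=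
      LinearIndependent.of_comp (thetaSpace τ k).subtype (linearIndependent_thetaBasisFun hτ hk)
    simpa using hli.fintype_card_le_finrank

/-- The space of theta functions of degree `k` (entire functions with the periodicity
behaviour `f(z+1) = f(z)`, `f(z+τ) = exp(−2πi k z)·f(z)`) is a `ℂ`-linear subspace of
`ℂ → ℂ` of dimension `k`. -/
theorem thetaFunctions_degree_k_dimension (τ : ℂ) (hτ : 0 < τ.im) (k : ℕ) (hk : 1 ≤ k) :
    ∃ V : Submodule ℂ (ℂ → ℂ),
      (V : Set (ℂ → ℂ)) =
        {f : ℂ → ℂ | Differentiable ℂ f ∧ (∀ z : ℂ, f (z + 1) = f z) ∧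
          ∀ z : ℂ, f (z + τ) = Complex.exp (-(2 * Real.pi * Complex.I * k * z)) * f z} ∧
      Module.finrank ℂ V = k := by
  exact ⟨thetaSpace τ k, rfl, finrank_thetaSpace hτ hk⟩
end

section
/- Fix τ ∈ ℂ with Im τ > 0 and let z, w ∈ ℂ be such that z − w ∉ ℤ + τℤ. Then there exist α, β ∈ ℂ such that the degree-3 theta function P(ζ) = θ(ζ + α, τ)·θ(ζ + β, τ)·θ(ζ − α − β, τ) satisfies P(z) = 0 and P(w) ≠ 0. -/
open Complex

/-- `theta` is a translate of Mathlib's two-variable Jacobi theta function. -/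
lemma theta_eq_jacobiTheta₂ (z τ : ℂ) : theta z τ = jacobiTheta₂ (z - τ / 2) τ := by
  unfold theta jacobiTheta₂ jacobiTheta₂_term
  refine tsum_congr fun n ↦ ?_
  congr 1
  ring

lemma differentiable_theta {τ : ℂ} (hτ : 0 < τ.im) : Differentiable ℂ (theta · τ) := by
  simp_rw [theta_eq_jacobiTheta₂]
  intro z
  exact (differentiableAt_jacobiTheta₂_fst _ hτ).comp z
    (f := fun z : ℂ ↦ z - τ / 2) (by fun_prop)

lemma theta_add_one (z τ : ℂ) : theta (z + 1) τ = theta z τ := by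
  rw [theta_eq_jacobiTheta₂, theta_eq_jacobiTheta₂, ← jacobiTheta₂_add_left (z - τ / 2)]
  ring_nf

lemma theta_add_tau (z τ : ℂ) :
    theta (z + τ) τ = cexp (-(2 * Real.pi * I * z)) * theta z τ := by
  rw [theta_eq_jacobiTheta₂, theta_eq_jacobiTheta₂,
    show z + τ - τ / 2 = z - τ / 2 + τ by ring, jacobiTheta₂_add_left']
  ring_nf

lemma theta_half (τ : ℂ) : theta (1 / 2) τ = 0 := by
  have h : theta (1 / 2) τ = -theta (1 / 2) τ := by
    calc theta (1 / 2) τ = theta (-(1 / 2) + τ) τ := by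
          rw [theta_eq_jacobiTheta₂, theta_eq_jacobiTheta₂, ← jacobiTheta₂_neg_left]
          ring_nf
      _ = -theta (1 / 2) τ := by
          rw [theta_add_tau, ← theta_add_one (-(1 / 2)) τ,
            show -(2 * Real.pi * I * -(1 / 2)) = Real.pi * I by ring, exp_pi_mul_I]
          norm_num
  linear_combination h / 2

lemma integral_exp_two_pi_mul_int (n : ℤ) (hn : n ≠ 0) :
    ∫ x in (0 : ℝ)..1, cexp (2 * Real.pi * I * n * x) = 0 := by
  have hc : (2 * Real.pi * I * n : ℂ) ≠ 0 := by
    simp [Real.pi_ne_zero, hn]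
  rw [integral_exp_mul_complex hc,
    show 2 * Real.pi * I * n * (1 : ℝ) = n * (2 * Real.pi * I) by push_cast; ring,
    exp_int_mul_two_pi_mul_I]
  simp

lemma exists_theta_ne_zero {τ : ℂ} (hτ : 0 < τ.im) : ∃ z, theta z τ ≠ 0 := by
  by_contra! hzero
  have hs : HasSum (fun n : ℤ ↦ ∫ x in (0 : ℝ)..1,
      jacobiTheta₂_term n x τ) (∫ x in (0 : ℝ)..1, ∑' n : ℤ, jacobiTheta₂_term n x τ) := by
    let F (n : ℤ) : C(ℝ, ℂ) := ⟨fun x ↦ jacobiTheta₂_term n x τ, by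
      unfold jacobiTheta₂_term; fun_prop⟩
    refine intervalIntegral.hasSum_intervalIntegral_of_summable_norm (f := F) ?_
    refine Summable.of_nonneg_of_le (fun _ ↦ norm_nonneg _) (fun n ↦ ?_)
      ((summable_jacobiTheta₂_term_iff 0 τ).mpr hτ).norm
    rw [ContinuousMap.norm_le _ (norm_nonneg _)]
    rintro ⟨x, -⟩
    simp [F, norm_jacobiTheta₂_term]
  have hcoeff : ∀ n : ℤ, ∫ x in (0 : ℝ)..1, jacobiTheta₂_term n x τ = if n = 0 then 1 else 0 := by
    intro n
    split_ifs with hn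
    · simp [hn, jacobiTheta₂_term]
    · simp_rw [jacobiTheta₂_term, Complex.exp_add]
      rw [intervalIntegral.integral_mul_const, integral_exp_two_pi_mul_int n hn, zero_mul]
  have hθ : ∀ x : ℝ, ∑' n : ℤ, jacobiTheta₂_term n x τ = 0 := by
    intro x
    have := hzero (x + τ / 2)
    rwa [theta_eq_jacobiTheta₂, add_sub_cancel_right] at this
  simp_rw [hcoeff, hθ] at hs
  have := hs.unique (hasSum_ite_eq 0 1)
  simp at this

/-- The infinite product `∏ (1 + y qⁿ)` over `n ≥ 0`. -/
noncomputable def eulerProd (q y : ℂ) : ℂ := ∏' n : ℕ, (1 + y * q ^ n)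

lemma summable_norm_mul_pow {q : ℂ} (hq : ‖q‖ < 1) (y : ℂ) :
    Summable fun n : ℕ ↦ ‖y * q ^ n‖ := by
  simpa using (summable_geometric_of_lt_one (norm_nonneg _) hq).mul_left ‖y‖

lemma eulerProd_eq_mul {q : ℂ} (hq : ‖q‖ < 1) (y : ℂ) :
    eulerProd q y = (1 + y) * eulerProd q (q * y) := by
  unfold eulerProd
  have hterm : ∀ n : ℕ, y * q ^ (n + 1) = q * y * q ^ n := fun n ↦ by ring
  have hm : Multipliable fun n : ℕ ↦ 1 + y * q ^ (n + 1) := by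
    simpa only [hterm] using multipliable_one_add_of_summable (summable_norm_mul_pow hq (q * y))
  rw [tprod_eq_zero_mul' (f := fun n ↦ 1 + y * q ^ n) hm]
  simp only [hterm, pow_zero, mul_one]

lemma exists_of_eulerProd_eq_zero {q : ℂ} (hq : ‖q‖ < 1) {y : ℂ} (h : eulerProd q y = 0) :
    ∃ n : ℕ, 1 + y * q ^ n = 0 := by
  by_contra! hne
  exact tprod_one_add_ne_zero_of_summable hne (summable_norm_mul_pow hq y) h

lemma differentiable_eulerProd {q : ℂ} (hq : ‖q‖ < 1) : Differentiable ℂ (eulerProd q) := by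
  have hprod : HasProdLocallyUniformlyOn (fun (n : ℕ) y ↦ 1 + y * q ^ n) (eulerProd q)
      Set.univ := by
    refine hasProdLocallyUniformlyOn_of_forall_compact isOpen_univ fun K _ hK ↦ ?_
    obtain ⟨C, hC⟩ := hK.isBounded.exists_norm_le
    refine ((summable_geometric_of_lt_one (norm_nonneg _) hq).mul_left
      C).hasProdUniformlyOn_nat_one_add hK (.of_forall fun n y hy ↦ ?_) (fun _ ↦ by fun_prop)
    rw [norm_mul, norm_pow]
    gcongr
    exact hC y hy
  rw [← differentiableOn_univ]
  exact hprod.differentiableOn (.of_forall fun _ ↦ by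
    simpa [Finset.prod_fn] using DifferentiableOn.finsetProd (fun _ _ ↦ by fun_prop)) isOpen_univ

lemma norm_exp_two_pi_I_mul_lt_one {τ : ℂ} (hτ : 0 < τ.im) :
    ‖cexp (2 * Real.pi * I * τ)‖ < 1 :=
  UpperHalfPlane.norm_exp_two_pi_I_lt_one ⟨τ, hτ⟩

/-- The Jacobi triple product, up to a constant factor. -/
noncomputable def thetaProd (τ z : ℂ) : ℂ :=
  eulerProd (cexp (2 * Real.pi * I * τ)) (cexp (2 * Real.pi * I * z)) *
    eulerProd (cexp (2 * Real.pi * I * τ)) (cexp (2 * Real.pi * I * (τ - z)))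

lemma differentiable_thetaProd {τ : ℂ} (hτ : 0 < τ.im) : Differentiable ℂ (thetaProd τ) := by
  have := differentiable_eulerProd (norm_exp_two_pi_I_mul_lt_one hτ)
  unfold thetaProd
  fun_prop

lemma thetaProd_add_one (z τ : ℂ) : thetaProd τ (z + 1) = thetaProd τ z := by
  unfold thetaProd
  rw [show 2 * Real.pi * I * (z + 1) = 2 * Real.pi * I * z + 2 * Real.pi * I by ring,
    show 2 * Real.pi * I * (τ - (z + 1)) = 2 * Real.pi * I * (τ - z) - 2 * Real.pi * I by ring,
    exp_periodic, exp_periodic.sub_eq]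

lemma thetaProd_add_tau {τ : ℂ} (hτ : 0 < τ.im) (z : ℂ) :
    thetaProd τ (z + τ) = cexp (-(2 * Real.pi * I * z)) * thetaProd τ z := by
  have hq := norm_exp_two_pi_I_mul_lt_one hτ
  unfold thetaProd
  rw [eulerProd_eq_mul hq (cexp (2 * Real.pi * I * z)),
    show 2 * Real.pi * I * (τ - (z + τ)) = -(2 * Real.pi * I * z) by ring,
    eulerProd_eq_mul hq (cexp (-(2 * Real.pi * I * z))), ← Complex.exp_add, ← Complex.exp_add,
    show 2 * Real.pi * I * (z + τ) = 2 * Real.pi * I * τ + 2 * Real.pi * I * z by ring,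
    show 2 * Real.pi * I * (τ - z) = 2 * Real.pi * I * τ + -(2 * Real.pi * I * z) by ring]
  have h : cexp (-(2 * Real.pi * I * z)) * cexp (2 * Real.pi * I * z) = 1 := by
    rw [← Complex.exp_add, neg_add_cancel, Complex.exp_zero]
  linear_combination (-(eulerProd (cexp (2 * Real.pi * I * τ))
      (cexp (2 * Real.pi * I * τ + 2 * Real.pi * I * z)) *
    eulerProd (cexp (2 * Real.pi * I * τ))
      (cexp (2 * Real.pi * I * τ + -(2 * Real.pi * I * z))))) * h

lemma exists_of_one_add_exp_eq_zero {u : ℂ} (h : 1 + cexp (2 * Real.pi * I * u) = 0) :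
    ∃ m : ℤ, u = 1 / 2 + m := by
  have h1 : cexp (2 * Real.pi * I * u) = cexp (Real.pi * I) := by
    rw [exp_pi_mul_I]
    linear_combination h
  obtain ⟨m, hm⟩ := Complex.exp_eq_exp_iff_exists_int.mp h1
  refine ⟨m, mul_left_cancel₀ two_pi_I_ne_zero ?_⟩
  linear_combination hm

lemma exists_of_thetaProd_eq_zero {τ : ℂ} (hτ : 0 < τ.im) {z : ℂ} (h : thetaProd τ z = 0) :
    ∃ m n : ℤ, z = 1 / 2 + m + n * τ := by
  have hq := norm_exp_two_pi_I_mul_lt_one hτ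
  have key : ∀ u : ℂ, eulerProd (cexp (2 * Real.pi * I * τ)) (cexp (2 * Real.pi * I * u)) = 0 →
      ∃ (m : ℤ) (n : ℕ), u + n * τ = 1 / 2 + m := by
    intro u hu
    obtain ⟨n, hn⟩ := exists_of_eulerProd_eq_zero hq hu
    rw [← Complex.exp_nat_mul, ← Complex.exp_add,
      show 2 * Real.pi * I * u + n * (2 * Real.pi * I * τ) = 2 * Real.pi * I * (u + n * τ) by
        ring] at hn
    obtain ⟨m, hm⟩ := exists_of_one_add_exp_eq_zero hn
    exact ⟨m, n, hm⟩
  rcases mul_eq_zero.mp h with h | h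
  · obtain ⟨m, n, hmn⟩ := key _ h
    refine ⟨m, -n, ?_⟩
    push_cast
    linear_combination hmn
  · obtain ⟨m, n, hmn⟩ := key _ h
    refine ⟨-1 - m, n + 1, ?_⟩
    push_cast
    linear_combination -hmn

lemma exp_two_pi_I_mul_half : cexp (2 * Real.pi * I * (1 / 2)) = -1 := by
  rw [show 2 * Real.pi * I * (1 / 2) = Real.pi * I by ring, exp_pi_mul_I]

lemma thetaProd_half {τ : ℂ} (hτ : 0 < τ.im) : thetaProd τ (1 / 2) = 0 := by
  rw [thetaProd, eulerProd_eq_mul (norm_exp_two_pi_I_mul_lt_one hτ), exp_two_pi_I_mul_half]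
  simp

lemma deriv_thetaProd_half_ne_zero {τ : ℂ} (hτ : 0 < τ.im) :
    deriv (thetaProd τ) (1 / 2) ≠ 0 := by
  have hq := norm_exp_two_pi_I_mul_lt_one hτ
  set q := cexp (2 * Real.pi * I * τ) with hqdef
  have hdiff := differentiable_eulerProd hq
  set R : ℂ → ℂ := fun z ↦ eulerProd q (q * cexp (2 * Real.pi * I * z)) *
    eulerProd q (cexp (2 * Real.pi * I * (τ - z))) with hR
  have hRd : Differentiable ℂ R := by fun_prop
  have hne : eulerProd q (-q) ≠ 0 := by
    intro h0
    obtain ⟨n, hn⟩ := exists_of_eulerProd_eq_zero hq h0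
    have h1 : q ^ (n + 1) = 1 := by linear_combination -hn
    have h2 := congrArg norm h1
    rw [norm_pow, norm_one] at h2
    exact (pow_lt_one₀ (norm_nonneg _) hq n.succ_ne_zero).ne h2
  have hRne : R (1 / 2) ≠ 0 := by
    have h1 : cexp (2 * Real.pi * I * (τ - 1 / 2)) = -q := by
      rw [mul_sub, Complex.exp_sub, exp_two_pi_I_mul_half, hqdef, div_neg, div_one]
    have h2 : q * cexp (2 * Real.pi * I * (1 / 2)) = -q := by
      rw [exp_two_pi_I_mul_half]; ring
    simp only [hR, h1, h2]
    exact mul_ne_zero hne hne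
  have hP : thetaProd τ = fun z ↦ (1 + cexp (2 * Real.pi * I * z)) * R z := by
    funext z
    rw [thetaProd, eulerProd_eq_mul hq (cexp (2 * Real.pi * I * z)), mul_assoc]
  have he : HasDerivAt (fun z : ℂ ↦ 1 + cexp (2 * Real.pi * I * z))
      (cexp (2 * Real.pi * I * (1 / 2)) * (2 * Real.pi * I * 1)) (1 / 2) :=
    (((hasDerivAt_id (1 / 2 : ℂ)).const_mul (2 * Real.pi * I)).cexp).const_add 1
  rw [hP, (he.fun_mul (hRd _).hasDerivAt).deriv, exp_two_pi_I_mul_half]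
  simpa [Real.pi_ne_zero] using hRne

/-- An entire function with periods `1` and `τ` is constant. -/
lemma apply_eq_apply_of_periodic {τ : ℂ} (hτ : 0 < τ.im) {h : ℂ → ℂ} (hd : Differentiable ℂ h)
    (h1 : Function.Periodic h 1) (h2 : Function.Periodic h τ) (z w : ℂ) : h z = h w := by
  refine hd.apply_eq_apply_of_bounded ?_ z w
  let φ : ℝ × ℝ → ℂ := fun p ↦ h (p.1 + p.2 * τ)
  have hφ : Continuous φ := hd.continuous.comp (by fun_prop)
  refine ((isCompact_Icc.prod isCompact_Icc).image hφ (s := Set.Icc (0 : ℝ) 1 ×ˢ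
    Set.Icc (0 : ℝ) 1)).isBounded.subset ?_
  rintro _ ⟨u, rfl⟩
  set b := u.im / τ.im with hb
  set a := u.re - b * τ.re with ha
  refine ⟨(Int.fract a, Int.fract b), ⟨⟨Int.fract_nonneg _, (Int.fract_lt_one _).le⟩,
    ⟨Int.fract_nonneg _, (Int.fract_lt_one _).le⟩⟩, ?_⟩
  have hu : u = (Int.fract a : ℝ) + (Int.fract b : ℝ) * τ + ⌊a⌋ * 1 + ⌊b⌋ * τ := by
    have ha' : (a : ℂ) = (Int.fract a : ℝ) + ⌊a⌋ := by
      rw [← Complex.ofReal_intCast, ← Complex.ofReal_add, Int.fract_add_floor]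
    have hb' : (b : ℂ) = (Int.fract b : ℝ) + ⌊b⌋ := by
      rw [← Complex.ofReal_intCast, ← Complex.ofReal_add, Int.fract_add_floor]
    have hab : u = a + b * τ := by
      apply Complex.ext
      · simp [ha]
      · simp [hb, hτ.ne']
    linear_combination hab + ha' + τ * hb'
  conv_rhs => rw [hu]
  rw [h2.int_mul, h1.int_mul]

/-- Two entire functions with the same nonvanishing multipliers along `1` and `τ` are
proportional, if both vanish at `a` and the zeros of the second one are simple and congruent
to `a`. -/
lemma exists_eq_const_mul_of_quasiperiodic {τ a : ℂ} (hτ : 0 < τ.im) {f g e : ℂ → ℂ}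
    (he : ∀ z, e z ≠ 0) (hf : Differentiable ℂ f) (hg : Differentiable ℂ g)
    (hf1 : ∀ z, f (z + 1) = f z) (hg1 : ∀ z, g (z + 1) = g z)
    (hfτ : ∀ z, f (z + τ) = e z * f z) (hgτ : ∀ z, g (z + τ) = e z * g z)
    (hfa : f a = 0) (hga : g a = 0) (hga' : deriv g a ≠ 0)
    (hzero : ∀ z, g z = 0 → ∃ m n : ℤ, z = a + m + n * τ) :
    ∃ c, ∀ z, f z = c * g z := by
  classical
  set h : ℂ → ℂ := fun z ↦ if g z = 0 then deriv f a / deriv g a else f z / g z with hh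
  have h1 : Function.Periodic h 1 := fun z ↦ by simp [hh, hf1, hg1]
  have h2 : Function.Periodic h τ := fun z ↦ by
    simp [hh, hfτ, hgτ, he, mul_div_mul_left]
  have hda : DifferentiableAt ℂ h a := by
    have hslope : ∀ {k : ℂ → ℂ}, Differentiable ℂ k → DifferentiableAt ℂ (dslope k a) a :=
      fun hk ↦ ((Complex.differentiableOn_dslope Filter.univ_mem).mpr
        hk.differentiableOn).differentiableAt Filter.univ_mem
    have hga0 : dslope g a a ≠ 0 := by rwa [dslope_same]
    refine ((hslope hf).div (hslope hg) hga0).congr_of_eventuallyEq ?_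
    filter_upwards [(hslope hg).continuousAt.eventually_ne hga0] with z hz
    rcases eq_or_ne z a with rfl | hza
    · simp [hh, hga]
    · have hsub : z - a ≠ 0 := sub_ne_zero.mpr hza
      have hfz : f z = (z - a) * dslope f a z := by
        simpa [hfa] using (sub_smul_dslope f a z).symm
      have hgz : g z = (z - a) * dslope g a z := by
        simpa [hga] using (sub_smul_dslope g a z).symm
      have hgz0 : g z ≠ 0 := hgz ▸ mul_ne_zero hsub hz
      simp only [hh, if_neg hgz0, Pi.div_apply]
      rw [hfz, hgz, mul_div_mul_left _ _ hsub]
  have hd : Differentiable ℂ h := by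
    intro z
    by_cases hz : g z = 0
    · obtain ⟨m, n, rfl⟩ := hzero z hz
      have hshift : h = fun u ↦ h (u - (m * 1 + n * τ)) := by
        funext u
        have := ((h1.int_mul m).add_period (h2.int_mul n)) (u - (m * 1 + n * τ))
        rw [← this, sub_add_cancel]
      rw [hshift]
      have hpt : a + m + n * τ - (m * 1 + n * τ) = a := by ring
      exact DifferentiableAt.comp (a + m + n * τ) (g := h) (f := fun u ↦ u - (m * 1 + n * τ))
        (by rwa [hpt]) (by fun_prop)
    · refine ((hf z).div (hg z) hz).congr_of_eventuallyEq ?_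
      filter_upwards [(hg z).continuousAt.eventually_ne hz] with u hu
      simp [hh, hu]
  refine ⟨h a, fun z ↦ ?_⟩
  by_cases hz : g z = 0
  · obtain ⟨m, n, rfl⟩ := hzero z hz
    have p1 : Function.Periodic (fun u ↦ f u = 0) 1 := fun u ↦ by simp [hf1]
    have p2 : Function.Periodic (fun u ↦ f u = 0) τ := fun u ↦ by simp [hfτ, he]
    have h0 := (((p1.int_mul m).add_period (p2.int_mul n)) a).mpr hfa
    rw [mul_one, ← add_assoc] at h0
    rw [hz, h0, mul_zero]
  · rw [apply_eq_apply_of_periodic hτ hd h1 h2 a z]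
    simp [hh, hz]

/-- All zeros of `theta` are congruent to `1 / 2` modulo the lattice `ℤ + τℤ`. -/
lemma exists_of_theta_eq_zero {τ : ℂ} (hτ : 0 < τ.im) {z : ℂ} (h : theta z τ = 0) :
    ∃ m n : ℤ, z = 1 / 2 + m + n * τ := by
  obtain ⟨c, hc⟩ := exists_eq_const_mul_of_quasiperiodic hτ (f := (theta · τ))
    (g := thetaProd τ) (fun z ↦ Complex.exp_ne_zero (-(2 * Real.pi * I * z)))
    (differentiable_theta hτ) (differentiable_thetaProd hτ) (theta_add_one · τ)
    (thetaProd_add_one · τ) (theta_add_tau · τ) (thetaProd_add_tau hτ) (theta_half τ)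
    (thetaProd_half hτ) (deriv_thetaProd_half_ne_zero hτ)
    (fun _ ↦ exists_of_thetaProd_eq_zero hτ)
  obtain ⟨u, hu⟩ := exists_theta_ne_zero hτ
  have hc0 : c ≠ 0 := fun h0 ↦ hu (by simpa [h0] using hc u)
  have hz := hc z
  simp only [h] at hz
  exact exists_of_thetaProd_eq_zero hτ ((mul_eq_zero.mp hz.symm).resolve_left hc0)

lemma countable_setOf_theta_eq_zero {τ : ℂ} (hτ : 0 < τ.im) :
    {z | theta z τ = 0}.Countable := by
  refine (Set.countable_range fun p : ℤ × ℤ ↦ (1 / 2 + p.1 + p.2 * τ : ℂ)).mono fun z hz ↦ ?_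
  obtain ⟨m, n, rfl⟩ := exists_of_theta_eq_zero hτ hz
  exact ⟨(m, n), rfl⟩

/-- For points `z, w` that are distinct modulo the lattice `ℤ + τℤ`, there is a
degree-3 theta function `ζ ↦ θ(ζ+α,τ)·θ(ζ+β,τ)·θ(ζ−α−β,τ)` vanishing at `z` but
not at `w`. -/
theorem exists_degree_three_separating (τ : ℂ) (hτ : 0 < τ.im) (z w : ℂ)
    (h : ¬ ∃ m n : ℤ, z - w = (m : ℂ) + (n : ℂ) * τ) :
    ∃ α β : ℂ,
      theta (z + α) τ * theta (z + β) τ * theta (z - α - β) τ = 0 ∧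
      theta (w + α) τ * theta (w + β) τ * theta (w - α - β) τ ≠ 0 := by
  have hZ := countable_setOf_theta_eq_zero hτ
  obtain ⟨β, hβ⟩ : ∃ β, β ∉ {β | theta (w + β) τ = 0} ∪ {β | theta (w - (1 / 2 - z) - β) τ = 0} :=
    (((hZ.preimage (add_right_injective w)).union
      (hZ.preimage (sub_right_injective (b := w - (1 / 2 - z))))).dense_compl ℝ).nonempty
  simp only [Set.mem_union, Set.mem_ofPred_eq, not_or] at hβ
  refine ⟨1 / 2 - z, β, ?_, mul_ne_zero (mul_ne_zero (fun h0 ↦ h ?_) hβ.1) hβ.2⟩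
  · rw [add_sub_cancel, theta_half, zero_mul, zero_mul]
  · obtain ⟨m, n, hmn⟩ := exists_of_theta_eq_zero hτ h0
    refine ⟨-m, -n, ?_⟩
    push_cast
    linear_combination -hmn
end

section
/- Fix τ ∈ ℂ with Im τ > 0 and constants d, γ ∈ ℂ with d ≠ 0. If φ : ℂ → ℂ is entire, satisfies φ(z+1) = φ(z) and φ(z+τ) = exp(−2πi z)·φ(z) for all z ∈ ℂ, and satisfies the constant-coefficient linear ODE (d/(4πi))·φ''(z) − (d/2)·φ'(z) − 2γ·φ(z) = 0 for all z ∈ ℂ, then φ is identically zero. In particular, a nonzero theta function of degree 1 cannot satisfy such an ODE. -/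
open Complex

/-- Differentiating a relation `f (z + τ) = exp (-(c z)) g z`. -/
theorem deriv_add_of_eq_exp_mul {f g : ℂ → ℂ} (hf : Differentiable ℂ f)
    (hg : Differentiable ℂ g) {τ c : ℂ}
    (h : ∀ z : ℂ, f (z + τ) = Complex.exp (-(c * z)) * g z) (z : ℂ) :
    deriv f (z + τ) = Complex.exp (-(c * z)) * (deriv g z - c * g z) := by
  have hexp : HasDerivAt (fun w : ℂ => Complex.exp (-(c * w)))
      (Complex.exp (-(c * z)) * (-(c * 1))) z :=
    (((hasDerivAt_id z).const_mul c).neg).cexp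
  have hright := hexp.mul (hg z).hasDerivAt
  have hleft := (hf (z + τ)).hasDerivAt.comp_add_const z τ
  rw [funext h] at hleft
  rw [hleft.unique hright]
  ring

/-- A theta function of degree 1 satisfying a constant-coefficient linear ODE
`(d/(4πi))·φ'' − (d/2)·φ' − 2γ·φ = 0` (with `d ≠ 0`) must vanish identically. -/
theorem degree_one_theta_ode_zero (τ : ℂ) (hτ : 0 < τ.im) (d γ : ℂ) (hd : d ≠ 0)
    (φ : ℂ → ℂ) (hφ : Differentiable ℂ φ)
    (h1 : ∀ z : ℂ, φ (z + 1) = φ z)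
    (h2 : ∀ z : ℂ, φ (z + τ) = Complex.exp (-(2 * Real.pi * Complex.I * z)) * φ z)
    (hode : ∀ z : ℂ, d / (4 * Real.pi * Complex.I) * deriv (deriv φ) z -
      d / 2 * deriv φ z - 2 * γ * φ z = 0) :
    ∀ z : ℂ, φ z = 0 := by
  have hc : (2 * Real.pi * Complex.I : ℂ) ≠ 0 := Complex.two_pi_I_ne_zero
  have h4 : (4 * Real.pi * Complex.I : ℂ) = 2 * (2 * Real.pi * Complex.I) := by ring
  rw [h4] at hode
  generalize (2 * Real.pi * Complex.I : ℂ) = c at hc h2 hode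
  have hφ' : Differentiable ℂ (deriv φ) := hφ.deriv
  have hd1 := deriv_add_of_eq_exp_mul hφ hφ h2
  have hd2 : ∀ z, deriv (deriv φ) (z + τ) =
      Complex.exp (-(c * z)) * (deriv (deriv φ) z - 2 * c * deriv φ z + c ^ 2 * φ z) := by
    intro z
    rw [deriv_add_of_eq_exp_mul hφ' (hφ'.sub (hφ.const_mul c)) hd1 z,
      ((hφ' z).hasDerivAt.sub ((hφ z).hasDerivAt.const_mul c)).deriv]
    simp only [Pi.sub_apply]
    ring
  have hfirst : ∀ z, deriv φ z = c * φ z := by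
    intro z
    have hE := Complex.exp_ne_zero (-(c * z))
    have hz := hode z
    have hzτ := hode (z + τ)
    rw [hd2, hd1, h2] at hzτ
    have key : d * Complex.exp (-(c * z)) * (deriv φ z - c * φ z) = 0 := by
      field_simp at hz hzτ
      have : 2 * c * (d * Complex.exp (-(c * z)) * (deriv φ z - c * φ z)) = 0 := by
        linear_combination Complex.exp (-(c * z)) * hz - hzτ
      simpa [hc] using this
    simpa [hd, hE, sub_eq_zero] using key
  intro z
  have hE := Complex.exp_ne_zero (-(c * z))
  have hzτ := hfirst (z + τ)
  rw [hd1, h2, hfirst z, sub_self, mul_zero] at hzτ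
  simpa [hc, hE] using hzτ.symm
end

section
/- Let y* ∈ ℝ and b, c ∈ ℂ. Suppose ξ : ℂ × ℂ → ℂ is entire (differentiable in the two complex variables jointly) and satisfies, for all (μ¹, μ²) ∈ ℂ²: ξ(μ¹+1, μ²) = ξ(μ¹, μ²); ξ(μ¹ + y* + i, μ²) = ξ(μ¹, μ²) − 2πi c; ξ(μ¹, μ²+1) = ξ(μ¹, μ²); and ξ(μ¹, μ² + i) = ξ(μ¹, μ²) − 2πi b. Then b = 0, c = 0, and ξ is constant. -/
open Complex

/-- A continuous function on `ℂ` with periods `1` and `y + i` is bounded. -/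
theorem isBounded_range_of_periodic {g : ℂ → ℂ} (hg : Continuous g) {y : ℝ}
    (h1 : Function.Periodic g 1) (h2 : Function.Periodic g (y + Complex.I)) :
    Bornology.IsBounded (Set.range g) := by
  refine ((isCompact_closedBall (0 : ℂ) 2).image hg).isBounded.subset ?_
  rintro _ ⟨z, rfl⟩
  set n : ℤ := ⌊z.im⌋ with hn
  set m : ℤ := ⌊z.re - n * y⌋ with hm
  refine ⟨z - n * (y + Complex.I) - m * 1, ?_, ?_⟩
  · rw [mem_closedBall_zero_iff]
    refine (Complex.norm_le_abs_re_add_abs_im _).trans ?_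
    have hre : (z - n * (y + Complex.I) - m * 1).re = z.re - n * y - m := by simp
    have him : (z - n * (y + Complex.I) - m * 1).im = z.im - n := by simp
    have hre' : |z.re - n * y - m| ≤ 1 :=
      abs_le.2 ⟨by linarith [Int.floor_le (z.re - n * y)],
        by linarith [Int.lt_floor_add_one (z.re - n * y)]⟩
    have him' : |z.im - n| ≤ 1 :=
      abs_le.2 ⟨by linarith [Int.floor_le z.im], by linarith [Int.lt_floor_add_one z.im]⟩
    rw [hre, him]
    linarith
  · rw [(h1.int_mul m).sub_eq, (h2.int_mul n).sub_eq]

/-- An entire function with period `1` which changes by a constant under translation by `y + i`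
is constant. -/
theorem eq_const_of_quasiperiodic {f : ℂ → ℂ} (hf : Differentiable ℂ f) {y : ℝ} {k : ℂ}
    (h1 : ∀ z, f (z + 1) = f z) (h2 : ∀ z, f (z + y + Complex.I) = f z - k) (z w : ℂ) :
    f z = f w := by
  have hd : Differentiable ℂ (deriv f) := hf.deriv
  have p1 : Function.Periodic (deriv f) 1 := fun z => by
    rw [← deriv_comp_add_const, funext h1]
  have p2 : Function.Periodic (deriv f) (y + Complex.I) := fun z => by
    have h : (fun z => f (z + (y + Complex.I))) = fun z => f z - k :=
      funext fun z => by rw [← add_assoc, h2]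
    rw [← deriv_comp_add_const, h, deriv_sub_const]
  obtain ⟨a, ha⟩ := hd.exists_const_forall_eq_of_bounded
    (isBounded_range_of_periodic hd.continuous p1 p2)
  have hconst : ∀ z w, f z - a * z = f w - a * w := by
    refine is_const_of_deriv_eq_zero (f := fun z => f z - a * z) (𝕜 := ℂ) (by fun_prop) fun z => ?_
    have h := (hf z).hasDerivAt.sub ((hasDerivAt_id z).const_mul a)
    rw [ha z, mul_one, sub_self] at h
    exact h.deriv
  have ha0 : a = 0 := by
    have h := hconst (0 + 1) 0
    rw [h1] at h
    linear_combination -h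
  simpa [ha0] using hconst z w

/-- An entire function `ξ : ℂ² → ℂ` satisfying the periodicity conditions
`ξ(μ¹+1,μ²) = ξ(μ¹,μ²)`, `ξ(μ¹+y*+i,μ²) = ξ(μ¹,μ²) − 2πi c`,
`ξ(μ¹,μ²+1) = ξ(μ¹,μ²)`, `ξ(μ¹,μ²+i) = ξ(μ¹,μ²) − 2πi b`
forces `b = 0`, `c = 0` and `ξ` constant. -/
theorem entire_periodic_constant (yStar : ℝ) (b c : ℂ) (ξ : ℂ × ℂ → ℂ)
    (hξ : Differentiable ℂ ξ)
    (h1 : ∀ μ₁ μ₂ : ℂ, ξ (μ₁ + 1, μ₂) = ξ (μ₁, μ₂))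
    (h2 : ∀ μ₁ μ₂ : ℂ, ξ (μ₁ + (yStar : ℂ) + Complex.I, μ₂) =
      ξ (μ₁, μ₂) - 2 * Real.pi * Complex.I * c)
    (h3 : ∀ μ₁ μ₂ : ℂ, ξ (μ₁, μ₂ + 1) = ξ (μ₁, μ₂))
    (h4 : ∀ μ₁ μ₂ : ℂ, ξ (μ₁, μ₂ + Complex.I) =
      ξ (μ₁, μ₂) - 2 * Real.pi * Complex.I * b) :
    b = 0 ∧ c = 0 ∧ ∃ C : ℂ, ∀ μ : ℂ × ℂ, ξ μ = C := by
  have e1 : ∀ v z w, ξ (z, v) = ξ (w, v) := fun v =>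
    eq_const_of_quasiperiodic (f := fun z => ξ (z, v)) (by fun_prop)
      (fun z => h1 z v) (fun z => h2 z v)
  have e2 : ∀ u z w, ξ (u, z) = ξ (u, w) := fun u =>
    eq_const_of_quasiperiodic (f := fun z => ξ (u, z)) (y := 0) (by fun_prop)
      (fun z => h3 u z) (fun z => by simpa using h4 u z)
  refine ⟨?_, ?_, ξ 0, fun μ => (e1 μ.2 μ.1 0).trans (e2 0 μ.2 0)⟩
  · have h := h4 0 0
    rw [e2 0 _ 0, eq_comm, sub_eq_self] at h
    simpa [Real.pi_ne_zero] using h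
  · have h := h2 0 0
    rw [e1 0 _ 0, eq_comm, sub_eq_self] at h
    simpa [Real.pi_ne_zero] using h
end
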